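/- arXiv:1810.03030 — 3 statements merged into one kernel-verified Lean document; each statement's English description precedes it below -/
import Mathlib

section
/- The variance of the point-treatment efficient influence function decomposes orthogonally: E_p[(D*)²] = E_p[ (1{a'=a}/g(l))² · (y(y) − Q(l))² ] + Σ_l pL(l) · (Q(l) − ψ)²; in particular the cross term E_p[ (1{a'=a}/g(l)) · (y(y) − Q(l)) · (Q(l) − ψ) ] vanishes. -/
/-!
Point-treatment setting: `X` covariates, `A` treatments, `Yt` outcomes, `y : Yt → ℝ` the
real-valued outcome, `p` a full-support probability mass function on `X × A × Yt`.
STATEMENT 0: the efficient influence function of `ψ = E[Y^a]` has mean zero under `p`.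
-/

open Finset
open scoped Classical

noncomputable section

variable {X A Yt : Type}

variable [Fintype X] [Fintype A] [Fintype Yt]

/-- The covariate marginal `pL(l) = Σ_{a',y} p(l,a',y)`. -/
def pL (p : X × A × Yt → ℝ) (l : X) : ℝ := ∑ a' : A, ∑ yv : Yt, p (l, a', yv)

/-- The propensity `g(l) = (Σ_y p(l,a,y)) / pL(l)`. -/
def gP (p : X × A × Yt → ℝ) (a : A) (l : X) : ℝ := (∑ yv : Yt, p (l, a, yv)) / pL p l

/-- The outcome regression `Q(l) = (Σ_y y(y)·p(l,a,y)) / (Σ_y p(l,a,y))`. -/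
def Qr (y : Yt → ℝ) (p : X × A × Yt → ℝ) (a : A) (l : X) : ℝ :=
  (∑ yv : Yt, y yv * p (l, a, yv)) / ∑ yv : Yt, p (l, a, yv)

/-- The conditional outcome law `q(y∣l) = p(l,a,y) / (Σ_{y'} p(l,a,y'))`. -/
def qY (p : X × A × Yt → ℝ) (a : A) (l : X) (yv : Yt) : ℝ :=
  p (l, a, yv) / ∑ yv' : Yt, p (l, a, yv')

/-- The target parameter `ψ = Σ_l pL(l)·Q(l)`. -/
def ψp (y : Yt → ℝ) (p : X × A × Yt → ℝ) (a : A) : ℝ := ∑ l : X, pL p l * Qr y p a l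

/-- The efficient influence function
`D*(l,a',y) = 1{a'=a}/g(l) · (y(y) − Q(l)) + Q(l) − ψ`. -/
def Dstar (y : Yt → ℝ) (p : X × A × Yt → ℝ) (a : A) (o : X × A × Yt) : ℝ :=
  (if o.2.1 = a then (1 : ℝ) else 0) / gP p a o.1 * (y o.2.2 - Qr y p a o.1)
    + Qr y p a o.1 - ψp y p a
/-- The inverse-propensity-weighted residual is orthogonal to every function of the covariates. -/
theorem sum_weighted_residual_mul_eq_zero (p : X × A × Yt → ℝ) (y : Yt → ℝ) (a : A)
    (h : ∀ l, ∑ yv : Yt, p (l, a, yv) ≠ 0) (f : X → ℝ) :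
    ∑ o : X × A × Yt, p o * ((if o.2.1 = a then (1 : ℝ) else 0) / gP p a o.1
      * (y o.2.2 - Qr y p a o.1) * f o.1) = 0 := by
  simp only [Fintype.sum_prod_type]
  refine Finset.sum_eq_zero fun l _ => ?_
  have hres : ∑ yv : Yt, p (l, a, yv) * (y yv - Qr y p a l) = 0 := by
    simp only [mul_sub, Finset.sum_sub_distrib, ← Finset.sum_mul, Qr]
    rw [mul_div_cancel₀ _ (h l), sub_eq_zero]
    exact Finset.sum_congr rfl fun _ _ => mul_comm _ _
  rw [Finset.sum_eq_single a (fun a' _ ha => by simp [ha]) (by simp)]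
  calc ∑ yv : Yt, p (l, a, yv) * ((if a = a then (1 : ℝ) else 0) / gP p a l
        * (y yv - Qr y p a l) * f l)
      = (1 / gP p a l * f l) * ∑ yv : Yt, p (l, a, yv) * (y yv - Qr y p a l) := by
        rw [Finset.mul_sum]
        refine Finset.sum_congr rfl fun yv _ => ?_
        rw [if_pos rfl]
        ring
    _ = 0 := by rw [hres, mul_zero]

/-- The expectation of a function of the covariates is its expectation under `pL`. -/
theorem sum_mul_fst_eq_sum_pL_mul (p : X × A × Yt → ℝ) (f : X → ℝ) :
    ∑ o : X × A × Yt, p o * f o.1 = ∑ l : X, pL p l * f l := by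
  simp only [Fintype.sum_prod_type, pL, Finset.sum_mul]

/-- orthogonal decomposition of the variance of the point-treatment EIF,
and vanishing of the cross term. -/
theorem eif_variance_decomposition [Nonempty X] [Nonempty A] [Nonempty Yt]
    (p : X × A × Yt → ℝ) (hp : ∀ o, 0 < p o) (hp1 : ∑ o : X × A × Yt, p o = 1)
    (y : Yt → ℝ) (a : A) :
    (∑ o : X × A × Yt, p o * Dstar y p a o ^ 2
      = ∑ o : X × A × Yt,
          p o * (((if o.2.1 = a then (1 : ℝ) else 0) / gP p a o.1) ^ 2
            * (y o.2.2 - Qr y p a o.1) ^ 2)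
        + ∑ l : X, pL p l * (Qr y p a l - ψp y p a) ^ 2) ∧
    ∑ o : X × A × Yt,
        p o * ((if o.2.1 = a then (1 : ℝ) else 0) / gP p a o.1
          * (y o.2.2 - Qr y p a o.1) * (Qr y p a o.1 - ψp y p a)) = 0 := by
  have hcross := sum_weighted_residual_mul_eq_zero p y a
    (fun l => (Finset.sum_pos (fun yv _ => hp (l, a, yv)) Finset.univ_nonempty).ne')
    (fun l => Qr y p a l - ψp y p a)
  refine ⟨?_, hcross⟩
  rw [← sum_mul_fst_eq_sum_pL_mul p (fun l => (Qr y p a l - ψp y p a) ^ 2)]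
  refine Eq.trans ?_ ((congrArg (fun c => _ + 2 * c) hcross).trans (by rw [mul_zero, add_zero]))
  rw [Finset.mul_sum, ← Finset.sum_add_distrib, ← Finset.sum_add_distrib]
  refine Finset.sum_congr rfl fun o _ => ?_
  rw [Dstar]
  ring

end
end

section
/- Inverse probability weighting identity: for every t ∈ {1, …, K+1} and every function f : L_0 × ⋯ × L_t → ℝ, E_p[ H^d_t(ā(t−1), l̄(t−1)) · f(l̄(t)) ] = E_{P^d}[ f(l̄(t)) ] = Σ_{l̄(t)} P^d_t(l̄(t)) f(l̄(t)). -/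
/-!
Longitudinal data structure `O = (L(0), A(0), …, A(K), L(K+1))` with full-support pmf `p`.
Histories are encoded by full trajectories together with agreement predicates on time prefixes;
a sum over histories `l̄(t)` is encoded as a sum over full covariate trajectories whose
coordinates beyond `t` are pinned to an arbitrary base point `l₀` (`tailEq`).
-/

open Finset
open scoped Classical

noncomputable section

variable {K : ℕ} {L : Fin (K + 2) → Type} {A : Fin (K + 1) → Type}

/-- Covariate trajectories. -/
abbrev Traj (K : ℕ) (L : Fin (K + 2) → Type) : Type := ∀ s : Fin (K + 2), L s

/-- Treatment trajectories. -/
abbrev Trt (K : ℕ) (A : Fin (K + 1) → Type) : Type := ∀ s : Fin (K + 1), A s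

/-- Observations. -/
abbrev Obs (K : ℕ) (L : Fin (K + 2) → Type) (A : Fin (K + 1) → Type) : Type :=
  Traj K L × Trt K A

/-- Agreement of covariate trajectories on time indices `< t` (i.e. they share `l̄(t-1)`). -/
def aL (t : ℕ) (l l' : Traj K L) : Prop := ∀ s : Fin (K + 2), (s : ℕ) < t → l s = l' s

/-- Agreement of treatment trajectories on time indices `< t` (i.e. they share `ā(t-1)`). -/
def aA (t : ℕ) (a a' : Trt K A) : Prop := ∀ s : Fin (K + 1), (s : ℕ) < t → a s = a' s

variable [∀ t, Fintype (L t)] [∀ t, Fintype (A t)]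

/-- Mass of the event that the covariates agree with `l` on indices `< tL` and the treatments
agree with `a` on indices `< tA`. -/
def marg (p : Obs K L A → ℝ) (tL tA : ℕ) (l : Traj K L) (a : Trt K A) : ℝ :=
  ∑ o' : Obs K L A, if aL tL l o'.1 ∧ aA tA a o'.2 then p o' else 0

/-- The conditional factor `q_t(l_t ∣ l̄(t-1), ā(t-1))`. -/
def qC (p : Obs K L A → ℝ) (t : ℕ) (l : Traj K L) (a : Trt K A) : ℝ :=
  marg p (t + 1) t l a / marg p t t l a

/-- The treatment mechanism factor `g_t(a_t ∣ l̄(t), ā(t-1))`. -/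
def gC (p : Obs K L A → ℝ) (t : ℕ) (l : Traj K L) (a : Trt K A) : ℝ :=
  marg p (t + 1) (t + 1) l a / marg p (t + 1) t l a

/-- The cumulative treatment probability `g_{0:t-1}(ā(t-1), l̄(t-1))`; in particular
`gCum p 0 = 1` is the convention `g_{0:-1} = 1`. -/
def gCum (p : Obs K L A → ℝ) (t : ℕ) (l : Traj K L) (a : Trt K A) : ℝ :=
  ∏ m ∈ Finset.range t, gC p m l a

/-- The treatment trajectory determined by the regimen `d` along the covariates `l`. -/
def aOf (d : ∀ t : Fin (K + 1), Traj K L → A t) (l : Traj K L) : Trt K A := fun s => d s l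

/-- A regimen is adapted: `d_t` depends only on `l̄(t)`. -/
def Adapted (d : ∀ t : Fin (K + 1), Traj K L → A t) : Prop :=
  ∀ t : Fin (K + 1), ∀ l l' : Traj K L, aL ((t : ℕ) + 1) l l' → d t l = d t l'

/-- The event `ā(t-1) = d(l̄(t-1))`. -/
def follows (d : ∀ t : Fin (K + 1), Traj K L → A t) (t : ℕ) (o : Obs K L A) : Prop :=
  ∀ s : Fin (K + 1), (s : ℕ) < t → o.2 s = d s o.1

/-- The inverse probability weight
`H^d_t(ā(t-1), l̄(t-1)) = 1{ā(t-1) = d(l̄(t-1))} / g_{0:t-1}`; `Hd p d 0 = 1`. -/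
def Hd (p : Obs K L A → ℝ) (d : ∀ t : Fin (K + 1), Traj K L → A t) (t : ℕ)
    (o : Obs K L A) : ℝ :=
  (if follows d t o then (1 : ℝ) else 0) / gCum p t o.1 o.2

/-- The sequential regression `Q̄^d_t(l̄(t-1))`, defined downward from
`Q̄^d_{K+2}(l̄(K+1)) = y(l_{K+1})` by
`Q̄^d_t(l̄(t-1)) = Σ_{l_t} q_t(l_t ∣ l̄(t-1), d(l̄(t-1))) Q̄^d_{t+1}(l̄(t))`. -/
def Qbar (p : Obs K L A → ℝ) (y : L (Fin.last (K + 1)) → ℝ)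
    (d : ∀ t : Fin (K + 1), Traj K L → A t) (t : ℕ) (l : Traj K L) : ℝ :=
  if ht : t < K + 2 then
    ∑ v : L ⟨t, ht⟩,
      qC p t (Function.update l ⟨t, ht⟩ v) (aOf d (Function.update l ⟨t, ht⟩ v)) *
        Qbar p y d (t + 1) (Function.update l ⟨t, ht⟩ v)
  else y (l (Fin.last (K + 1)))
termination_by K + 2 - t
decreasing_by omega

/-- The G-computation mass `P^d_t(l̄(t)) = Π_{m=0}^{t} q_m(l_m ∣ l̄(m-1), d(l̄(m-1)))`. -/
def Pd (p : Obs K L A → ℝ) (d : ∀ t : Fin (K + 1), Traj K L → A t) (t : ℕ)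
    (l : Traj K L) : ℝ :=
  ∏ m ∈ Finset.range (t + 1), qC p m l (aOf d l)

/-- `l` agrees with the base point `l₀` on indices `> t`: summing a function of `l̄(t)` over
trajectories pinned to `l₀` beyond `t` realizes the sum over histories `l̄(t)`. -/
def tailEq (t : ℕ) (l₀ l : Traj K L) : Prop := ∀ s : Fin (K + 2), t < (s : ℕ) → l s = l₀ s

/-- The `t`-th component of the efficient influence function,
`D^{*,d}_t = H^d_t · (Q̄^d_{t+1} - Q̄^d_t)` (with `H^d_0 = 1`, so the `t = 0` component is
`Q̄^d_1(l_0) - Q̄^d_0`). -/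
def Dst (p : Obs K L A → ℝ) (y : L (Fin.last (K + 1)) → ℝ)
    (d : ∀ t : Fin (K + 1), Traj K L → A t) (t : ℕ) (o : Obs K L A) : ℝ :=
  Hd p d t o * (Qbar p y d (t + 1) o.1 - Qbar p y d t o.1)

omit [∀ t, Fintype (L t)] in
theorem aL.symm {t : ℕ} {l l' : Traj K L} (h : aL t l l') : aL t l' l :=
  fun s hs => (h s hs).symm

omit [∀ t, Fintype (L t)] in
theorem aL.trans {t : ℕ} {l l' l'' : Traj K L} (h : aL t l l') (h' : aL t l' l'') : aL t l l'' :=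
  fun s hs => (h s hs).trans (h' s hs)

omit [∀ t, Fintype (L t)] in
theorem aL.mono {t u : ℕ} {l l' : Traj K L} (h : aL t l l') (hu : u ≤ t) : aL u l l' :=
  fun s hs => h s (hs.trans_le hu)

omit [∀ t, Fintype (A t)] in
theorem aA.symm {t : ℕ} {a a' : Trt K A} (h : aA t a a') : aA t a' a :=
  fun s hs => (h s hs).symm

omit [∀ t, Fintype (A t)] in
theorem aA.trans {t : ℕ} {a a' a'' : Trt K A} (h : aA t a a') (h' : aA t a' a'') : aA t a a'' :=
  fun s hs => (h s hs).trans (h' s hs)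

omit [∀ t, Fintype (A t)] in
theorem aA.mono {t u : ℕ} {a a' : Trt K A} (h : aA t a a') (hu : u ≤ t) : aA u a a' :=
  fun s hs => h s (hs.trans_le hu)

theorem marg_congr (p : Obs K L A → ℝ) {tL tA : ℕ} {l l' : Traj K L} {a a' : Trt K A}
    (hl : aL tL l l') (ha : aA tA a a') : marg p tL tA l a = marg p tL tA l' a' :=
  Finset.sum_congr rfl fun _ _ => if_congr
    ⟨fun h => ⟨hl.symm.trans h.1, ha.symm.trans h.2⟩, fun h => ⟨hl.trans h.1, ha.trans h.2⟩⟩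
    rfl rfl

theorem gCum_congr (p : Obs K L A → ℝ) {t : ℕ} {l l' : Traj K L} {a a' : Trt K A}
    (hl : aL t l l') (ha : aA t a a') : gCum p t l a = gCum p t l' a' := by
  refine Finset.prod_congr rfl fun m hm => ?_
  have hm : m < t := Finset.mem_range.mp hm
  unfold gC
  rw [marg_congr p (hl.mono hm) (ha.mono hm), marg_congr p (hl.mono hm) (ha.mono hm.le)]

theorem marg_pos {p : Obs K L A → ℝ} (hp : ∀ o, 0 < p o) (tL tA : ℕ) (l : Traj K L)
    (a : Trt K A) : 0 < marg p tL tA l a := by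
  refine Finset.sum_pos' (fun o _ => ?_) ⟨(l, a), Finset.mem_univ _, ?_⟩
  · split_ifs
    exacts [(hp o).le, le_rfl]
  · rw [if_pos ⟨fun _ _ => rfl, fun _ _ => rfl⟩]
    exact hp _

theorem gCum_pos {p : Obs K L A → ℝ} (hp : ∀ o, 0 < p o) (t : ℕ) (l : Traj K L)
    (a : Trt K A) : 0 < gCum p t l a :=
  Finset.prod_pos fun _ _ => div_pos (marg_pos hp _ _ _ _) (marg_pos hp _ _ _ _)

/-- Chain rule for the mass of a history `(l̄(t-1), ā(t-1))`. -/
theorem marg_eq_gCum_mul_prod_qC {p : Obs K L A → ℝ} (hp : ∀ o, 0 < p o)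
    (hp1 : ∑ o : Obs K L A, p o = 1) (t : ℕ) (l : Traj K L) (a : Trt K A) :
    marg p t t l a = gCum p t l a * ∏ m ∈ Finset.range t, qC p m l a := by
  induction t with
  | zero => simp [marg, gCum, aL, aA, hp1]
  | succ t ih =>
    have h₀ := (marg_pos hp t t l a).ne'
    have h₁ := (marg_pos hp (t + 1) t l a).ne'
    have hg : gCum p (t + 1) l a = gCum p t l a * gC p t l a := Finset.prod_range_succ _ _
    rw [hg, Finset.prod_range_succ, mul_mul_mul_comm, ← ih, gC, qC]
    field_simp

theorem marg_succ_eq_gCum_mul_Pd {p : Obs K L A → ℝ} (hp : ∀ o, 0 < p o)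
    (hp1 : ∑ o : Obs K L A, p o = 1) (d : ∀ t : Fin (K + 1), Traj K L → A t) (t : ℕ)
    (l : Traj K L) : marg p (t + 1) t l (aOf d l) = gCum p t l (aOf d l) * Pd p d t l := by
  have h₀ := (marg_pos hp t t l (aOf d l)).ne'
  rw [Pd, Finset.prod_range_succ, ← mul_assoc, ← marg_eq_gCum_mul_prod_qC hp hp1, qC,
    mul_div_cancel₀ _ h₀]

omit [∀ t, Fintype (L t)] [∀ t, Fintype (A t)] in
theorem aA_aOf {d : ∀ t : Fin (K + 1), Traj K L → A t} (hd : Adapted d) {t : ℕ}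
    {l l' : Traj K L} (h : aL t l l') : aA t (aOf d l) (aOf d l') :=
  fun s hs => hd s l l' (h.mono hs)

omit [∀ t, Fintype (L t)] [∀ t, Fintype (A t)] in
theorem follows_iff_aA {d : ∀ t : Fin (K + 1), Traj K L → A t} (hd : Adapted d) {t : ℕ}
    {l : Traj K L} {o : Obs K L A} (h : aL t l o.1) : follows d t o ↔ aA t (aOf d l) o.2 :=
  ⟨fun hf => (aA_aOf hd h).trans (aA.symm hf), fun ha => ha.symm.trans (aA_aOf hd h)⟩

/-- Each trajectory has exactly one representative pinned to `l₀` beyond `t`. -/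
theorem sum_tailEq_aL (t : ℕ) (l₀ l' : Traj K L) (c : ℝ) :
    (∑ l : Traj K L, if tailEq t l₀ l ∧ aL (t + 1) l l' then c else 0) = c := by
  have h (l : Traj K L) : (tailEq t l₀ l ∧ aL (t + 1) l l') ↔
      l = fun s : Fin (K + 2) => if (s : ℕ) < t + 1 then l' s else l₀ s := by
    constructor
    · rintro ⟨h₁, h₂⟩
      funext s
      split_ifs with hs
      exacts [h₂ s hs, h₁ s (by omega)]
    · rintro rfl
      exact ⟨fun s hs => if_neg (by omega), fun s hs => if_pos hs⟩
  simp [h]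

/-- The weighted mass of the observations whose covariates share a given history `l̄(t)`. -/
theorem sum_aL_mul_Hd {p : Obs K L A → ℝ} (hp : ∀ o, 0 < p o)
    (hp1 : ∑ o : Obs K L A, p o = 1) {d : ∀ t : Fin (K + 1), Traj K L → A t} (hd : Adapted d)
    (t : ℕ) (l : Traj K L) :
    (∑ o : Obs K L A, if aL (t + 1) l o.1 then p o * Hd p d t o else 0) = Pd p d t l := by
  have hg := (gCum_pos hp t l (aOf d l)).ne'
  rw [← mul_div_cancel_left₀ (Pd p d t l) hg, ← marg_succ_eq_gCum_mul_Pd hp hp1, marg,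
    Finset.sum_div]
  refine Finset.sum_congr rfl fun o _ => ?_
  by_cases hl : aL (t + 1) l o.1
  · have hl' : aL t l o.1 := hl.mono t.le_succ
    by_cases ha : aA t (aOf d l) o.2
    · simp [hl, ha, Hd, (follows_iff_aA hd hl').2 ha, gCum_congr p hl' ha, div_eq_mul_inv]
    · simp [hl, ha, Hd, mt (follows_iff_aA hd hl').1 ha]
  · simp [hl]

/-- inverse probability weighting identity
`E_p[H^d_t · f(l̄(t))] = E_{P^d}[f(l̄(t))] = Σ_{l̄(t)} P^d_t(l̄(t)) f(l̄(t))`. -/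
theorem ipw_gcomp_identity [∀ t, Nonempty (L t)] [∀ t, Nonempty (A t)]
    (p : Obs K L A → ℝ) (hp : ∀ o, 0 < p o) (hp1 : ∑ o : Obs K L A, p o = 1)
    (d : ∀ t : Fin (K + 1), Traj K L → A t) (hd : Adapted d)
    (t : ℕ) (ht1 : 1 ≤ t) (ht2 : t ≤ K + 1)
    (f : Traj K L → ℝ) (hf : ∀ l l' : Traj K L, aL (t + 1) l l' → f l = f l')
    (l₀ : Traj K L) :
    ∑ o : Obs K L A, p o * (Hd p d t o * f o.1)
      = ∑ l : Traj K L, if tailEq t l₀ l then Pd p d t l * f l else 0 := by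
  calc ∑ o : Obs K L A, p o * (Hd p d t o * f o.1)
      = ∑ o : Obs K L A, ∑ l : Traj K L,
          if tailEq t l₀ l ∧ aL (t + 1) l o.1 then p o * (Hd p d t o * f o.1) else 0 := by
        simp only [sum_tailEq_aL]
    _ = ∑ l : Traj K L, ∑ o : Obs K L A,
          if tailEq t l₀ l ∧ aL (t + 1) l o.1 then p o * (Hd p d t o * f o.1) else 0 :=
        Finset.sum_comm
    _ = ∑ l : Traj K L, if tailEq t l₀ l then Pd p d t l * f l else 0 := by
        refine Finset.sum_congr rfl fun l _ => ?_
        by_cases htail : tailEq t l₀ l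
        · simp only [htail, true_and, if_true]
          rw [← sum_aL_mul_Hd hp hp1 hd, Finset.sum_mul]
          refine Finset.sum_congr rfl fun o _ => ?_
          split_ifs with hl
          · rw [hf l o.1 hl, mul_assoc]
          · rw [zero_mul]
        · simp [htail]

end
end

section
/- Counterfactual representation of the variance of the longitudinal efficient influence function: σ²_0 := E_p[(D^{*,d})²] = Σ_{t=0}^{K+1} Σ_{l̄(t)} P^d_t(l̄(t)) · (Q̄^d_{t+1}(l̄(t)) − Q̄^d_t(l̄(t−1)))² / g_{0:t−1}(d(l̄(t−1)), l̄(t−1)), where the t = 0 term (with g_{0:−1} = 1) equals Σ_{l_0} q_0(l_0) · (Q̄^d_1(l_0) − Q̄^d_0)². -/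
/-!
Longitudinal data structure `O = (L(0), A(0), …, A(K), L(K+1))` with full-support pmf `p`.
Histories are encoded by full trajectories together with agreement predicates on time prefixes;
a sum over histories `l̄(t)` is encoded as a sum over full covariate trajectories whose
coordinates beyond `t` are pinned to an arbitrary base point `l₀` (`tailEq`).
-/

open Finset
open scoped Classical

noncomputable section

variable {K : ℕ} {L : Fin (K + 2) → Type} {A : Fin (K + 1) → Type}

variable [∀ t, Fintype (L t)] [∀ t, Fintype (A t)]

omit [∀ t, Fintype (L t)] in
theorem aL_mono {s t : ℕ} (hst : s ≤ t) {l l' : Traj K L} (h : aL t l l') : aL s l l' :=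
  fun i hi => h i (hi.trans_le hst)

omit [∀ t, Fintype (L t)] in
theorem aL_update (t : ℕ) (ht : t < K + 2) (l : Traj K L) (v : L ⟨t, ht⟩) :
    aL t (Function.update l ⟨t, ht⟩ v) l := by
  intro s hs
  exact Function.update_of_ne (fun h => by simp [h] at hs) _ _

omit [∀ t, Fintype (L t)] in
theorem aL_succ_update_iff (t : ℕ) (ht : t < K + 2) (l l' : Traj K L) (v : L ⟨t, ht⟩) :
    aL (t + 1) (Function.update l ⟨t, ht⟩ v) l' ↔ aL t l l' ∧ v = l' ⟨t, ht⟩ := by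
  constructor
  · intro h
    refine ⟨fun s hs => ?_, ?_⟩
    · rw [← h s (by omega), aL_update t ht l v s hs]
    · simpa using h ⟨t, ht⟩ (by simp)
  · rintro ⟨h, rfl⟩ s hs
    rcases Nat.lt_succ_iff_lt_or_eq.1 hs with hs | hs
    · rw [aL_update t ht l _ s hs, h s hs]
    · obtain rfl : s = ⟨t, ht⟩ := Fin.ext hs
      simp

omit [∀ t, Fintype (L t)] in
theorem tailEq_update_iff (t : ℕ) (ht : t < K + 2) (l₀ l : Traj K L) (v : L ⟨t, ht⟩) :
    tailEq t l₀ (Function.update l ⟨t, ht⟩ v) ↔ tailEq t l₀ l := by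
  refine forall_congr' fun s => forall_congr' fun hs => ?_
  rw [Function.update_of_ne (fun h => by simp [h] at hs)]

omit [∀ t, Fintype (L t)] [∀ t, Fintype (A t)] in
theorem aA_aOf_iff_follows {d : ∀ t : Fin (K + 1), Traj K L → A t} (t : ℕ) (o : Obs K L A) :
    aA t (aOf d o.1) o.2 ↔ follows d t o :=
  forall_congr' fun _ => forall_congr' fun _ => eq_comm

omit [∀ t, Fintype (A t)] in
theorem aA_mono {s t : ℕ} (hst : s ≤ t) {a a' : Trt K A} (h : aA t a a') : aA s a a' :=
  fun i hi => h i (hi.trans_le hst)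

theorem qC_congr (p : Obs K L A → ℝ) {t : ℕ} {l l' : Traj K L} {a a' : Trt K A}
    (hl : aL (t + 1) l l') (ha : aA t a a') : qC p t l a = qC p t l' a' := by
  rw [qC, qC, marg_congr p hl ha, marg_congr p (aL_mono t.le_succ hl) ha]

theorem qC_mul_marg {p : Obs K L A → ℝ} (hp : ∀ o, 0 < p o) (t : ℕ) (l : Traj K L)
    (a : Trt K A) : qC p t l a * marg p t t l a = marg p (t + 1) t l a :=
  div_mul_cancel₀ _ (marg_pos hp _ _ _ _).ne'

theorem gC_mul_marg {p : Obs K L A → ℝ} (hp : ∀ o, 0 < p o) (t : ℕ) (l : Traj K L)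
    (a : Trt K A) : gC p t l a * marg p (t + 1) t l a = marg p (t + 1) (t + 1) l a :=
  div_mul_cancel₀ _ (marg_pos hp _ _ _ _).ne'

/-- The marginal mass factorizes into covariate and treatment factors. -/
theorem marg_eq_prod_mul_gCum {p : Obs K L A → ℝ} (hp : ∀ o, 0 < p o)
    (hp1 : ∑ o : Obs K L A, p o = 1) (l : Traj K L) (a : Trt K A) (t : ℕ) :
    marg p (t + 1) t l a = (∏ m ∈ Finset.range (t + 1), qC p m l a) * gCum p t l a := by
  induction t with
  | zero =>
    have h : marg p 0 0 l a = 1 := by simp [marg, aL, aA, hp1]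
    rw [← qC_mul_marg hp, h]
    simp [gCum]
  | succ t ih =>
    rw [← qC_mul_marg hp, ← gC_mul_marg hp, ih, Finset.prod_range_succ _ (t + 1), gCum, gCum,
      Finset.prod_range_succ (fun m => gC p m l a) t]
    ring

theorem Qbar_of_lt (p : Obs K L A → ℝ) (y : L (Fin.last (K + 1)) → ℝ)
    (d : ∀ t : Fin (K + 1), Traj K L → A t) (t : ℕ) (ht : t < K + 2) (l : Traj K L) :
    Qbar p y d t l = ∑ v : L ⟨t, ht⟩,
      qC p t (Function.update l ⟨t, ht⟩ v) (aOf d (Function.update l ⟨t, ht⟩ v)) *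
        Qbar p y d (t + 1) (Function.update l ⟨t, ht⟩ v) := by
  rw [Qbar, dif_pos ht]

theorem Qbar_congr (p : Obs K L A → ℝ) (y : L (Fin.last (K + 1)) → ℝ)
    {d : ∀ t : Fin (K + 1), Traj K L → A t} (hd : Adapted d) (t : ℕ) {l l' : Traj K L}
    (h : aL t l l') : Qbar p y d t l = Qbar p y d t l' := by
  by_cases ht : t < K + 2
  · rw [Qbar_of_lt p y d t ht, Qbar_of_lt p y d t ht]
    refine Finset.sum_congr rfl fun v _ => ?_
    have hu : aL (t + 1) (Function.update l ⟨t, ht⟩ v) (Function.update l' ⟨t, ht⟩ v) := by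
      refine (aL_succ_update_iff t ht _ _ _).2 ⟨fun s hs => ?_, by simp⟩
      rw [h s hs, aL_update t ht l' v s hs]
    rw [qC_congr p hu (aA_aOf hd (aL_mono t.le_succ hu)), Qbar_congr p y hd (t + 1) hu]
  · rw [Qbar, Qbar, dif_neg ht, dif_neg ht, h _ (by simp; omega)]
termination_by K + 2 - t

/-- The conditional factor `q_t` sums to one over `l_t`. -/
theorem sum_qC_update {p : Obs K L A → ℝ} (hp : ∀ o, 0 < p o)
    {d : ∀ t : Fin (K + 1), Traj K L → A t} (hd : Adapted d) (t : ℕ) (ht : t < K + 2)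
    (l : Traj K L) :
    ∑ v : L ⟨t, ht⟩,
      qC p t (Function.update l ⟨t, ht⟩ v) (aOf d (Function.update l ⟨t, ht⟩ v)) = 1 := by
  have hu := aL_update t ht l
  have h1 : ∀ v, qC p t (Function.update l ⟨t, ht⟩ v) (aOf d (Function.update l ⟨t, ht⟩ v)) =
      marg p (t + 1) t (Function.update l ⟨t, ht⟩ v) (aOf d l) / marg p t t l (aOf d l) := by
    intro v
    rw [qC, marg_congr p (hu v) (aA_aOf hd (hu v)),
      marg_congr p (fun _ _ => rfl) (aA_aOf hd (hu v))]
  rw [Finset.sum_congr rfl fun v _ => h1 v, ← Finset.sum_div,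
    div_eq_one_iff_eq (marg_pos hp _ _ _ _).ne']
  simp only [marg]
  rw [Finset.sum_comm]
  refine Finset.sum_congr rfl fun o _ => ?_
  rw [Finset.sum_eq_single (o.1 ⟨t, ht⟩)]
  · simp only [aL_succ_update_iff, and_true]
  · intro v _ hv
    rw [if_neg]
    simp [aL_succ_update_iff, hv]
  · simp

/-- A sum over a product type vanishes if all its partial sums along one coordinate do. -/
theorem sum_eq_zero_of_sum_update {n : ℕ} {M : Fin n → Type} [∀ i, Fintype (M i)]
    [∀ i, Nonempty (M i)] (i : Fin n) (G : (∀ j, M j) → ℝ)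
    (h : ∀ l, ∑ v : M i, G (Function.update l i v) = 0) : ∑ l, G l = 0 := by
  rw [← (Equiv.piSplitAt i M).symm.sum_comp, Fintype.sum_prod_type, Finset.sum_comm]
  refine Finset.sum_eq_zero fun r _ => ?_
  rw [← h ((Equiv.piSplitAt i M).symm (Classical.arbitrary _, r))]
  refine Finset.sum_congr rfl fun v _ => congrArg G ?_
  ext j
  by_cases hj : j = i
  · subst hj
    simp [Equiv.piSplitAt]
  · simp [Equiv.piSplitAt, hj]

/-- Expectations over observations following `d` as sums over covariate histories. -/
theorem sum_follows_eq (p : Obs K L A → ℝ) {d : ∀ t : Fin (K + 1), Traj K L → A t}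
    (hd : Adapted d) (l₀ : Traj K L) (t : ℕ) (f : Traj K L → ℝ)
    (hf : ∀ l l', aL (t + 1) l l' → f l = f l') :
    ∑ o : Obs K L A, (if follows d t o then p o * f o.1 else 0) =
      ∑ l : Traj K L, if tailEq t l₀ l then marg p (t + 1) t l (aOf d l) * f l else 0 := by
  have h1 : ∀ l : Traj K L,
      (if tailEq t l₀ l then marg p (t + 1) t l (aOf d l) * f l else 0) =
      ∑ o : Obs K L A, if tailEq t l₀ l ∧ aL (t + 1) l o.1 ∧ aA t (aOf d l) o.2
        then p o * f l else 0 := by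
    intro l
    by_cases h : tailEq t l₀ l
    · simp only [h, if_true, true_and, marg, Finset.sum_mul, ite_mul, zero_mul]
    · simp [h]
  rw [Finset.sum_congr rfl fun l _ => h1 l, Finset.sum_comm]
  refine Finset.sum_congr rfl fun o _ => ?_
  set m : Traj K L := fun s => if (s : ℕ) < t + 1 then o.1 s else l₀ s with hm
  have hmL : aL (t + 1) m o.1 := fun s hs => by simp only [hm, if_pos hs]
  have hmT : tailEq t l₀ m := fun s hs => by simp only [hm]; rw [if_neg (by omega)]
  rw [Finset.sum_eq_single m]
  · have ha : aA t (aOf d m) o.2 ↔ follows d t o := by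
      rw [← aA_aOf_iff_follows]
      have := aA_aOf hd (aL_mono t.le_succ hmL)
      exact forall_congr' fun s => forall_congr' fun hs => by rw [this s hs]
    simp only [hmL, hmT, ha, true_and, hf m o.1 hmL]
  · intro l _ hl
    rw [if_neg]
    rintro ⟨hT, hL, -⟩
    refine hl (funext fun s => ?_)
    by_cases hs : (s : ℕ) < t + 1
    · rw [hL s hs, hmL s hs]
    · rw [hT s (by omega), hmT s (by omega)]
  · simp

/-- On the event that `d` is followed, the weight depends on the covariates only. -/
theorem Hd_eq (p : Obs K L A → ℝ) (d : ∀ t : Fin (K + 1), Traj K L → A t) (t : ℕ)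
    (o : Obs K L A) :
    Hd p d t o = if follows d t o then 1 / gCum p t o.1 (aOf d o.1) else 0 := by
  rw [Hd]
  split_ifs with h
  · rw [gCum_congr p (fun _ _ => rfl) ((aA_aOf_iff_follows t o).2 h)]
  · simp

theorem sum_mul_Dst_sq {p : Obs K L A → ℝ} (hp : ∀ o, 0 < p o)
    (hp1 : ∑ o : Obs K L A, p o = 1) (y : L (Fin.last (K + 1)) → ℝ)
    {d : ∀ t : Fin (K + 1), Traj K L → A t} (hd : Adapted d) (l₀ : Traj K L) (t : ℕ) :
    ∑ o : Obs K L A, p o * Dst p y d t o ^ 2 =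
      ∑ l : Traj K L, if tailEq t l₀ l then
        Pd p d t l * (Qbar p y d (t + 1) l - Qbar p y d t l) ^ 2 / gCum p t l (aOf d l)
      else 0 := by
  set f : Traj K L → ℝ := fun l =>
    (Qbar p y d (t + 1) l - Qbar p y d t l) ^ 2 / gCum p t l (aOf d l) ^ 2 with hf
  have h1 : ∀ o : Obs K L A, p o * Dst p y d t o ^ 2 =
      if follows d t o then p o * f o.1 else 0 := by
    intro o
    rw [Dst, Hd_eq]
    split_ifs
    · simp only [hf]
      ring
    · simp
  rw [Finset.sum_congr rfl fun o _ => h1 o, sum_follows_eq p hd l₀ t f]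
  · refine Finset.sum_congr rfl fun l _ => if_congr Iff.rfl ?_ rfl
    have := (gCum_pos hp t l (aOf d l)).ne'
    rw [marg_eq_prod_mul_gCum hp hp1, ← Pd]
    simp only [hf]
    field_simp
  · intro l l' h
    have h' := aL_mono t.le_succ h
    simp only [hf]
    rw [Qbar_congr p y hd _ h, Qbar_congr p y hd _ h', gCum_congr p h' (aA_aOf hd h')]

/-- Distinct components of the efficient influence function are orthogonal. -/
theorem sum_mul_Dst_mul_Dst [∀ t, Nonempty (L t)] {p : Obs K L A → ℝ} (hp : ∀ o, 0 < p o)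
    (y : L (Fin.last (K + 1)) → ℝ) {d : ∀ t : Fin (K + 1), Traj K L → A t} (hd : Adapted d)
    {s t : ℕ} (hst : s < t) (ht : t < K + 2) :
    ∑ o : Obs K L A, p o * (Dst p y d s o * Dst p y d t o) = 0 := by
  set h : Traj K L → ℝ := fun l => (Qbar p y d (s + 1) l - Qbar p y d s l) /
    (gCum p s l (aOf d l) * gCum p t l (aOf d l)) with hh
  have h_congr : ∀ l l', aL t l l' → h l = h l' := by
    intro l l' hl
    have hs := aL_mono hst.le hl
    simp only [hh]
    rw [Qbar_congr p y hd _ (aL_mono hst hl), Qbar_congr p y hd _ hs,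
      gCum_congr p hl (aA_aOf hd hl), gCum_congr p hs (aA_aOf hd hs)]
  have h1 : ∀ o : Obs K L A, p o * (Dst p y d s o * Dst p y d t o) =
      if follows d t o then
        p o * (h o.1 * (Qbar p y d (t + 1) o.1 - Qbar p y d t o.1)) else 0 := by
    intro o
    rw [Dst, Dst, Hd_eq, Hd_eq]
    by_cases ho : follows d t o
    · have ho' : follows d s o := fun i hi => ho i (hi.trans hst)
      rw [if_pos ho, if_pos ho, if_pos ho']
      simp only [hh]
      ring
    · simp [ho]
  rw [Finset.sum_congr rfl fun o _ => h1 o, sum_follows_eq p hd (Classical.arbitrary _) t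
    fun l => h l * (Qbar p y d (t + 1) l - Qbar p y d t l)]
  · refine sum_eq_zero_of_sum_update ⟨t, ht⟩ _ fun l => ?_
    simp only [tailEq_update_iff]
    split_ifs
    · have hu := aL_update t ht l
      calc _ = ∑ v : L ⟨t, ht⟩, marg p t t l (aOf d l) * h l *
            (qC p t (Function.update l ⟨t, ht⟩ v) (aOf d (Function.update l ⟨t, ht⟩ v)) *
              Qbar p y d (t + 1) (Function.update l ⟨t, ht⟩ v) -
            qC p t (Function.update l ⟨t, ht⟩ v) (aOf d (Function.update l ⟨t, ht⟩ v)) *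
              Qbar p y d t l) := by
            refine Finset.sum_congr rfl fun v _ => ?_
            rw [← qC_mul_marg hp, h_congr _ _ (hu v), Qbar_congr p y hd t (hu v),
              marg_congr p (hu v) (aA_aOf hd (hu v))]
            ring
        _ = 0 := by
            rw [← Finset.mul_sum, Finset.sum_sub_distrib, ← Finset.sum_mul,
              sum_qC_update hp hd, ← Qbar_of_lt, one_mul, sub_self, mul_zero]
    · simp
  · intro l l' hl
    have hl' := aL_mono t.le_succ hl
    rw [h_congr _ _ hl', Qbar_congr p y hd _ hl, Qbar_congr p y hd _ hl']

/-- counterfactual representation of the variance of the longitudinal EIF,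
`σ²_0 = Σ_{t=0}^{K+1} Σ_{l̄(t)} P^d_t(l̄(t)) (Q̄^d_{t+1} - Q̄^d_t)² / g_{0:t-1}(d(l̄(t-1)), l̄(t-1))`,
and the identification of the `t = 0` term as `Σ_{l_0} q_0(l_0) (Q̄^d_1(l_0) - Q̄^d_0)²`. -/
theorem eif_variance_counterfactual [∀ t, Nonempty (L t)] [∀ t, Nonempty (A t)]
    (p : Obs K L A → ℝ) (hp : ∀ o, 0 < p o) (hp1 : ∑ o : Obs K L A, p o = 1)
    (y : L (Fin.last (K + 1)) → ℝ)
    (d : ∀ t : Fin (K + 1), Traj K L → A t) (hd : Adapted d)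
    (l₀ : Traj K L) :
    (∑ o : Obs K L A, p o * (∑ t ∈ Finset.range (K + 2), Dst p y d t o) ^ 2
      = ∑ t ∈ Finset.range (K + 2), ∑ l : Traj K L,
          if tailEq t l₀ l then
            Pd p d t l * (Qbar p y d (t + 1) l - Qbar p y d t l) ^ 2 / gCum p t l (aOf d l)
          else 0) ∧
    (∑ l : Traj K L,
        if tailEq 0 l₀ l then
          Pd p d 0 l * (Qbar p y d 1 l - Qbar p y d 0 l) ^ 2 / gCum p 0 l (aOf d l)
        else 0)
      = ∑ l : Traj K L,
          if tailEq 0 l₀ l then qC p 0 l (aOf d l) * (Qbar p y d 1 l - Qbar p y d 0 l) ^ 2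
          else 0 := by
  constructor
  · have h0 : ∀ s ∈ Finset.range (K + 2), ∀ t ∈ Finset.range (K + 2), t ≠ s →
        ∑ o : Obs K L A, p o * (Dst p y d s o * Dst p y d t o) = 0 := by
      intro s hs t ht hst
      rw [Finset.mem_range] at hs ht
      rcases lt_or_gt_of_ne hst with h | h
      · simp only [mul_comm (Dst p y d s _)]
        exact sum_mul_Dst_mul_Dst hp y hd h hs
      · exact sum_mul_Dst_mul_Dst hp y hd h ht
    simp only [pow_two, Finset.sum_mul, Finset.mul_sum]
    rw [Finset.sum_comm]
    refine Finset.sum_congr rfl fun s hs => ?_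
    rw [Finset.sum_comm, Finset.sum_eq_single_of_mem s hs fun t ht h => h0 t ht s hs h.symm]
    simpa only [pow_two] using sum_mul_Dst_sq hp hp1 y hd l₀ s
  · simp [Pd, gCum]

end
end
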